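/- Fix q ∈ [0,1] and set C = |1 − 2q|; assume C > 0. Define, for w, z ∈ [0,1]: I(w,z) = h₂((w+z)/2) − (h₂(w) + h₂(z))/2 and Λ(w,z) = C·( wz/(w+z) + (1−w)(1−z)/(2−w−z) ), with the convention that fractions with zero denominator are 0. Let D_p ∈ [0, C/2], and set w* = (1 + √(1 − 2D_p/C))/2 and z* = (1 − √(1 − 2D_p/C))/2. Then (w*, z*) is a solution of the optimization problem minimize I(w,z) over w, z ∈ [0,1] subject to Λ(w,z) ≤ D_p; i.e., Λ(w*, z*) ≤ D_p and I(w*, z*) ≤ I(w,z) for every (w,z) ∈ [0,1]² with Λ(w,z) ≤ D_p. -/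

import Mathlib

/-- Binary entropy function with base-2 logarithm (with `h₂ 0 = h₂ 1 = 0` by the
Lean convention `logb 2 0 = 0`). -/
noncomputable def binEnt (x : ℝ) : ℝ :=
  -(x * Real.logb 2 x) - (1 - x) * Real.logb 2 (1 - x)

/-- Mutual information `I(w,z)` of the binary test channel `[[w,1−w],[z,1−z]]`
with uniform input. -/
noncomputable def mutI (w z : ℝ) : ℝ :=
  binEnt ((w + z) / 2) - (binEnt w + binEnt z) / 2

/-- Expected total-variation semantic distortion `Λ(w,z)` (fractions with zero
denominator are `0` by the Lean convention `a / 0 = 0`). -/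
noncomputable def lamTV (C w z : ℝ) : ℝ :=
  C * (w * z / (w + z) + (1 - w) * (1 - z) / (2 - w - z))

/-- Expected Hamming distortion `Γ(w,z)`. -/
noncomputable def gamH (w z : ℝ) : ℝ := (1 + z - w) / 2

/-- The threshold `a(D_o)`. -/
noncomputable def aThresh (C Do_ : ℝ) : ℝ :=
  if Do_ ≤ 1 / 2 then 2 * C * Do_ * (1 - Do_) else C / 2

/-- The semantic rate distortion function `R(D_p, D_o)` for the binary case. -/
noncomputable def Rbin (C Dp Do_ : ℝ) : ℝ :=
  sInf {r : ℝ | ∃ w z : ℝ, w ∈ Set.Icc (0 : ℝ) 1 ∧ z ∈ Set.Icc (0 : ℝ) 1 ∧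
    lamTV C w z ≤ Dp ∧ gamH w z ≤ Do_ ∧ r = mutI w z}

open Real Set

/-- Binary entropy as a function of the squared bias `t = (2 p - 1) ^ 2`. -/
noncomputable def biasEntropy (t : ℝ) : ℝ :=
  binEntropy ((1 + √t) / 2)

lemma biasEntropy_sq (p : ℝ) : biasEntropy ((1 - 2 * p) ^ 2) = binEntropy p := by
  unfold biasEntropy
  rw [sqrt_sq_eq_abs]
  rcases abs_cases (1 - 2 * p) with ⟨h, -⟩ | ⟨h, -⟩
  · rw [h, ← binEntropy_one_sub p]
    congr 1
    ring
  · rw [h]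
    congr 1
    ring

lemma hasDerivAt_biasEntropy {t : ℝ} (ht : t ∈ Ioo (0 : ℝ) 1) :
    HasDerivAt biasEntropy (-((log (1 + √t) - log (1 - √t)) / √t) / 4) t := by
  have h0 : 0 < √t := sqrt_pos.2 ht.1
  have h1 : √t < 1 := (sqrt_lt' one_pos).2 (by simpa using ht.2)
  have hinner : HasDerivAt (fun s : ℝ ↦ (1 + √s) / 2) (1 / (2 * √t) / 2) t :=
    ((hasDerivAt_sqrt ht.1.ne').const_add 1).div_const 2
  have houter : HasDerivAt binEntropy _ ((1 + √t) / 2) :=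
    hasDerivAt_binEntropy (by linarith) (by linarith)
  refine (houter.comp t hinner).congr_deriv ?_
  have e : 1 - (1 + √t) / 2 = (1 - √t) / 2 := by ring
  rw [e, log_div (by linarith) two_ne_zero, log_div (by linarith) two_ne_zero]
  field_simp
  ring

lemma monotoneOn_log_sub_log_div :
    MonotoneOn (fun r : ℝ ↦ (log (1 + r) - log (1 - r)) / r) (Ioo 0 1) := by
  have series {r : ℝ} (hr : r ∈ Ioo (0 : ℝ) 1) :
      HasSum (fun k : ℕ ↦ 2 * (1 / (2 * k + 1)) * r ^ (2 * k + 1) / r)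
        ((log (1 + r) - log (1 - r)) / r) :=
    (hasSum_log_sub_log_of_abs_lt_one (abs_lt.2 ⟨by linarith [hr.1], hr.2⟩)).div_const r
  intro r hr s hs hrs
  refine hasSum_le (fun k ↦ ?_) (series hr) (series hs)
  have hr0 := hr.1
  have hs0 := hs.1
  rw [pow_succ, pow_succ, ← mul_assoc, ← mul_assoc, mul_div_cancel_right₀ _ hr0.ne',
    mul_div_cancel_right₀ _ hs0.ne']
  gcongr

lemma concaveOn_biasEntropy : ConcaveOn ℝ (Icc 0 1) biasEntropy := by
  refine AntitoneOn.concaveOn_of_deriv (convex_Icc 0 1) ?_ ?_ ?_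
  · unfold biasEntropy
    exact (binEntropy_continuous.comp (by fun_prop)).continuousOn
  · rw [interior_Icc]
    exact fun t ht ↦ (hasDerivAt_biasEntropy ht).differentiableAt.differentiableWithinAt
  · rw [interior_Icc]
    intro t ht s hs hts
    have sqrt_mem {x : ℝ} (hx : x ∈ Ioo (0 : ℝ) 1) : √x ∈ Ioo (0 : ℝ) 1 :=
      ⟨sqrt_pos.2 hx.1, (sqrt_lt' one_pos).2 (by simpa using hx.2)⟩
    rw [(hasDerivAt_biasEntropy ht).deriv, (hasDerivAt_biasEntropy hs).deriv]
    have := monotoneOn_log_sub_log_div (sqrt_mem ht) (sqrt_mem hs) (sqrt_le_sqrt hts)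
    simp only at this
    linarith

lemma antitoneOn_biasEntropy : AntitoneOn biasEntropy (Icc 0 1) := by
  intro t ht s hs hts
  have bounds {x : ℝ} (hx : x ∈ Icc (0 : ℝ) 1) : (1 + √x) / 2 ∈ Icc (2⁻¹ : ℝ) 1 := by
    have := sqrt_nonneg x
    have := sqrt_le_one.2 hx.2
    constructor <;> linarith
  refine binEntropy_strictAntiOn.antitoneOn (bounds ht) (bounds hs) ?_
  gcongr

lemma binEnt_eq_binEntropy_div (x : ℝ) : binEnt x = binEntropy x / log 2 := by
  rw [binEntropy_eq_negMulLog_add_negMulLog_one_sub]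
  simp only [binEnt, negMulLog, logb]
  ring

/-- `I(X;Y) = H(X) - H(X|Y)` for uniform `X`, with `m / 2 = P(Y = 1)` and `a`, `b` the
posterior probabilities of `X = 1` given the two values of `Y`. -/
lemma mutI_eq_of_posterior {w z m a b : ℝ} (hw : w = m * a) (hz : z = m * (1 - a))
    (hw' : 1 - w = (2 - m) * b) (hz' : 1 - z = (2 - m) * (1 - b)) :
    mutI w z =
      (log 2 - (m / 2 * binEntropy a + (1 - m / 2) * binEntropy b)) / log 2 := by
  have hs : (w + z) / 2 = m / 2 := by rw [hw, hz]; ring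
  have hm : negMulLog m = m / 2 * negMulLog 2 + 2 * negMulLog (m / 2) := by
    rw [← negMulLog_mul]; congr 1; ring
  have hm' : negMulLog (2 - m) =
      (1 - m / 2) * negMulLog 2 + 2 * negMulLog (1 - m / 2) := by
    rw [← negMulLog_mul]; congr 1; ring
  have h2 : negMulLog 2 = -(2 * log 2) := by simp [negMulLog]
  simp only [mutI, binEnt_eq_binEntropy_div, hs]
  simp only [binEntropy_eq_negMulLog_add_negMulLog_one_sub]
  rw [hw', hz', hw, hz]
  simp only [negMulLog_mul]
  rw [hm, hm', h2]
  ring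

lemma exists_posterior {w z : ℝ} (hw : 0 ≤ w) (hz : 0 ≤ z) :
    ∃ a ∈ Icc (0 : ℝ) 1, w = (w + z) * a ∧ z = (w + z) * (1 - a) ∧
      w * z / (w + z) = (w + z) * (a * (1 - a)) := by
  rcases (add_nonneg hw hz).eq_or_lt with h | h
  · obtain rfl : w = 0 := by linarith
    obtain rfl : z = 0 := by linarith
    exact ⟨0, by simp⟩
  · refine ⟨w / (w + z), ⟨by positivity, (div_le_one h).2 (by linarith)⟩, ?_, ?_, ?_⟩ <;>
      field_simp <;> ring

lemma sq_bias_mem_Icc {p : ℝ} (hp : p ∈ Icc (0 : ℝ) 1) :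
    (1 - 2 * p) ^ 2 ∈ Icc (0 : ℝ) 1 :=
  ⟨sq_nonneg _, by nlinarith [mul_nonneg hp.1 (sub_nonneg.2 hp.2)]⟩

/-- Proposition 6: for `D_p ∈ [0, C/2]`, the pair
`w* = (1+√(1−2D_p/C))/2`, `z* = (1−√(1−2D_p/C))/2` solves
`min I(w,z)` over `w,z ∈ [0,1]` subject to `Λ(w,z) ≤ D_p`. -/
theorem binary_minimizer_of_mutual_information
    (q : ℝ) (hq : q ∈ Set.Icc (0 : ℝ) 1)
    (C : ℝ) (hC : C = |1 - 2 * q|) (hCpos : 0 < C)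
    (Dp : ℝ) (hDp : Dp ∈ Set.Icc (0 : ℝ) (C / 2)) :
    lamTV C ((1 + Real.sqrt (1 - 2 * Dp / C)) / 2)
        ((1 - Real.sqrt (1 - 2 * Dp / C)) / 2) ≤ Dp ∧
    ∀ w z : ℝ, w ∈ Set.Icc (0 : ℝ) 1 → z ∈ Set.Icc (0 : ℝ) 1 →
      lamTV C w z ≤ Dp →
      mutI ((1 + Real.sqrt (1 - 2 * Dp / C)) / 2)
          ((1 - Real.sqrt (1 - 2 * Dp / C)) / 2) ≤ mutI w z := by
  obtain ⟨hD0, hD1⟩ := hDp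
  have hDC : Dp / C ≤ 1 / 2 := by rw [div_le_iff₀ hCpos]; linarith
  have hDC0 : 0 ≤ Dp / C := by positivity
  have ht : 1 - 2 * Dp / C ∈ Icc (0 : ℝ) 1 := by
    rw [mul_div_assoc]; constructor <;> linarith
  have hsq := sq_sqrt ht.1
  set r := √(1 - 2 * Dp / C) with hr
  constructor
  · apply le_of_eq
    have e1 : (1 + r) / 2 + (1 - r) / 2 = 1 := by ring
    have e2 : 2 - (1 + r) / 2 - (1 - r) / 2 = 1 := by ring
    rw [lamTV, e1, e2]
    calc _ = C * ((1 - r ^ 2) / 2) := by ring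
      _ = Dp := by rw [hsq]; field_simp; ring
  intro w z hw hz hΛ
  obtain ⟨a, ha, hwa, hza, hprod⟩ := exists_posterior hw.1 hz.1
  obtain ⟨b, hb, hwb, hzb, hprod'⟩ := exists_posterior (sub_nonneg.2 hw.2) (sub_nonneg.2 hz.2)
  have hm : 1 - w + (1 - z) = 2 - (w + z) := by ring
  rw [hm] at hwb hzb hprod'
  have hstar : mutI ((1 + r) / 2) ((1 - r) / 2) =
      (log 2 - biasEntropy (1 - 2 * Dp / C)) / log 2 := by
    rw [mutI_eq_of_posterior (m := 1) (a := (1 + r) / 2) (b := (1 - r) / 2)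
      (by ring) (by ring) (by ring) (by ring), biasEntropy, ← hr,
      show (1 - r) / 2 = 1 - (1 + r) / 2 by ring, binEntropy_one_sub]
    ring
  rw [hstar, mutI_eq_of_posterior hwa hza hwb hzb]
  have hm0 : 0 ≤ (w + z) / 2 := by linarith [hw.1, hz.1]
  have hm1 : 0 ≤ 1 - (w + z) / 2 := by linarith [hw.2, hz.2]
  have hconc := concaveOn_biasEntropy.2 (sq_bias_mem_Icc ha) (sq_bias_mem_Icc hb) hm0 hm1
    (by ring)
  have hmem := convex_Icc (0 : ℝ) 1 (sq_bias_mem_Icc ha) (sq_bias_mem_Icc hb) hm0 hm1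
    (by ring)
  simp only [smul_eq_mul, biasEntropy_sq] at hconc hmem
  have hbias : 1 - 2 * Dp / C ≤
      (w + z) / 2 * (1 - 2 * a) ^ 2 + (1 - (w + z) / 2) * (1 - 2 * b) ^ 2 := by
    have hle : (w + z) * (a * (1 - a)) + (2 - (w + z)) * (b * (1 - b)) ≤ Dp / C := by
      rw [le_div_iff₀' hCpos, ← hprod, ← hprod', ← sub_sub]
      exact hΛ
    rw [mul_div_assoc]
    linarith
  have := antitoneOn_biasEntropy ht hmem hbias
  have := log_pos one_lt_two
  gcongr
  linarith
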